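/- arXiv:2406.10947 — 4 statements merged into one kernel-verified Lean document; each statement's English description precedes it below -/
import Mathlib

section
/- For α,β ∈ ℂ with β ≠ α, let C39^{α,β} be the compatible pre-Lie algebra on ℂ² with first multiplication e1·e1 = e1, e2·e2 = e2 and second multiplication e1∗e1 = α e1, e2∗e2 = β e2. Then for α,β,α',β' ∈ ℂ with β ≠ α and β' ≠ α', the algebras C39^{α,β} and C39^{α',β'} are isomorphic as compatible pre-Lie algebras if and only if (α,β) = (α',β') or (α,β) = (β',α'). -/
open scoped BigOperators

/-- The underlying vector space `ℂ²`. -/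
abbrev V2 : Type := Fin 2 → ℂ

/-- The first standard basis vector of `ℂ²`. -/
noncomputable def e1 : V2 := ![1, 0]

/-- The second standard basis vector of `ℂ²`. -/
noncomputable def e2 : V2 := ![0, 1]

/-- The bilinear multiplication on `ℂ²` with multiplication table `f`,
i.e. the product of the `i`-th and `j`-th basis vectors is `f i j`. -/
noncomputable def bil (f : Fin 2 → Fin 2 → V2) : V2 →ₗ[ℂ] V2 →ₗ[ℂ] V2 :=
  LinearMap.mk₂ ℂ (fun x y => ∑ i : Fin 2, ∑ j : Fin 2, (x i * y j) • f i j)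
    (fun x x' y => by
      simp only [Pi.add_apply, add_mul, add_smul, Finset.sum_add_distrib])
    (fun c x y => by
      simp only [Pi.smul_apply, smul_eq_mul, Finset.smul_sum, smul_smul]
      refine Finset.sum_congr rfl fun i _ => Finset.sum_congr rfl fun j _ => ?_
      congr 1
      ring)
    (fun x y y' => by
      simp only [Pi.add_apply, mul_add, add_smul, Finset.sum_add_distrib])
    (fun c x y => by
      simp only [Pi.smul_apply, smul_eq_mul, Finset.smul_sum, smul_smul]
      refine Finset.sum_congr rfl fun i _ => Finset.sum_congr rfl fun j _ => ?_
      congr 1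
      ring)

/-- A bilinear map is a pre-Lie multiplication if it satisfies the (right)
pre-Lie identity. -/
def IsPreLie {V : Type*} [AddCommGroup V] [Module ℂ V]
    (μ : V →ₗ[ℂ] V →ₗ[ℂ] V) : Prop :=
  ∀ x y z : V, μ (μ x y) z - μ x (μ y z) = μ (μ y x) z - μ y (μ x z)

/-- `(V, μ, ν)` is a compatible pre-Lie algebra: `μ`, `ν` and `μ + ν` are all
pre-Lie multiplications. -/
def IsCompatPreLie {V : Type*} [AddCommGroup V] [Module ℂ V]
    (μ ν : V →ₗ[ℂ] V →ₗ[ℂ] V) : Prop :=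
  IsPreLie μ ∧ IsPreLie ν ∧ IsPreLie (μ + ν)

/-- Isomorphism of the two-multiplication algebras `(ℂ², μ, ν)` and `(ℂ², μ', ν')`. -/
def CompatIso (μ ν μ' ν' : V2 →ₗ[ℂ] V2 →ₗ[ℂ] V2) : Prop :=
  ∃ φ : V2 ≃ₗ[ℂ] V2, (∀ x y : V2, φ (μ x y) = μ' (φ x) (φ y)) ∧
    (∀ x y : V2, φ (ν x y) = ν' (φ x) (φ y))

/-- `C01 : e1·e1 = e1 + e2, e2·e1 = e2`. -/
noncomputable def C01 : V2 →ₗ[ℂ] V2 →ₗ[ℂ] V2 := bil ![![e1 + e2, 0], ![e2, 0]]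

/-- `C02 : e1·e1 = e1 + e2, e1·e2 = e2`. -/
noncomputable def C02 : V2 →ₗ[ℂ] V2 →ₗ[ℂ] V2 := bil ![![e1 + e2, e2], ![0, 0]]

/-- `C03 : e1·e1 = e2`. -/
noncomputable def C03 : V2 →ₗ[ℂ] V2 →ₗ[ℂ] V2 := bil ![![e2, 0], ![0, 0]]

/-- `C04 : e2·e1 = e1`. -/
noncomputable def C04 : V2 →ₗ[ℂ] V2 →ₗ[ℂ] V2 := bil ![![0, 0], ![e1, 0]]

/-- `C05^α : e1·e1 = e1, e1·e2 = α e2`. -/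
noncomputable def C05 (α : ℂ) : V2 →ₗ[ℂ] V2 →ₗ[ℂ] V2 := bil ![![e1, α • e2], ![0, 0]]

/-- `C06^α : e1·e1 = e1, e1·e2 = α e2, e2·e1 = e2`. -/
noncomputable def C06 (α : ℂ) : V2 →ₗ[ℂ] V2 →ₗ[ℂ] V2 := bil ![![e1, α • e2], ![e2, 0]]

/-- `C07 : e1·e1 = e1, e2·e2 = e2`. -/
noncomputable def C07 : V2 →ₗ[ℂ] V2 →ₗ[ℂ] V2 := bil ![![e1, 0], ![0, e2]]

/-- `C08 : e1·e1 = e1, e1·e2 = 2 e2, e2·e1 = (1/2) e1 + e2, e2·e2 = e2`. -/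
noncomputable def C08 : V2 →ₗ[ℂ] V2 →ₗ[ℂ] V2 :=
  bil ![![e1, (2 : ℂ) • e2], ![(1 / 2 : ℂ) • e1 + e2, e2]]

/-- The second multiplication of `C09^{α,β}`: `e1∗e1 = α e1, e1∗e2 = β e2, e2∗e1 = α e2`. -/
noncomputable def C09s (α β : ℂ) : V2 →ₗ[ℂ] V2 →ₗ[ℂ] V2 :=
  bil ![![α • e1, β • e2], ![α • e2, 0]]

/-- The second multiplication of `C10^{α,β}`: `e1∗e1 = α e1 + β e2, e2∗e1 = α e2`. -/
noncomputable def C10s (α β : ℂ) : V2 →ₗ[ℂ] V2 →ₗ[ℂ] V2 :=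
  bil ![![α • e1 + β • e2, 0], ![α • e2, 0]]

/-- The second multiplication of `C11^{α,β}`: `e1∗e1 = α e1, e1∗e2 = β e2`. -/
noncomputable def C11s (α β : ℂ) : V2 →ₗ[ℂ] V2 →ₗ[ℂ] V2 :=
  bil ![![α • e1, β • e2], ![0, 0]]

/-- The second multiplication of `C12^{α,β}`: `e1∗e1 = α e1 + β e2, e1∗e2 = α e2`. -/
noncomputable def C12s (α β : ℂ) : V2 →ₗ[ℂ] V2 →ₗ[ℂ] V2 :=
  bil ![![α • e1 + β • e2, α • e2], ![0, 0]]

/-- The second multiplication of `C13^α`: `e1∗e1 = α e1, e1∗e2 = e2, e2∗e1 = α e2`. -/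
noncomputable def C13s (α : ℂ) : V2 →ₗ[ℂ] V2 →ₗ[ℂ] V2 :=
  bil ![![α • e1, e2], ![α • e2, 0]]

/-- The second multiplication of `C14^α`: `e1∗e1 = e1 + α e2, e2∗e1 = e2`. -/
noncomputable def C14s (α : ℂ) : V2 →ₗ[ℂ] V2 →ₗ[ℂ] V2 :=
  bil ![![e1 + α • e2, 0], ![e2, 0]]

/-- The second multiplication of `C15^α`: `e1∗e1 = α e2`. -/
noncomputable def C15s (α : ℂ) : V2 →ₗ[ℂ] V2 →ₗ[ℂ] V2 :=
  bil ![![α • e2, 0], ![0, 0]]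

/-- The second multiplication of `C16^α`: `e1∗e1 = e1, e1∗e2 = α e2`. -/
noncomputable def C16s (α : ℂ) : V2 →ₗ[ℂ] V2 →ₗ[ℂ] V2 :=
  bil ![![e1, α • e2], ![0, 0]]

/-- The second multiplication of `C17^α`: `e1∗e1 = e1 + α e2, e1∗e2 = e2`. -/
noncomputable def C17s (α : ℂ) : V2 →ₗ[ℂ] V2 →ₗ[ℂ] V2 :=
  bil ![![e1 + α • e2, e2], ![0, 0]]

/-- The second multiplication of `C18^α`: `e1∗e1 = α e2, e1∗e2 = e1, e2∗e1 = e1, e2∗e2 = e2`. -/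
noncomputable def C18s (α : ℂ) : V2 →ₗ[ℂ] V2 →ₗ[ℂ] V2 :=
  bil ![![α • e2, e1], ![e1, e2]]

/-- The second multiplication of `C19^α`: `e1∗e1 = α e2, e2∗e1 = e1, e2∗e2 = 2 e2`. -/
noncomputable def C19s (α : ℂ) : V2 →ₗ[ℂ] V2 →ₗ[ℂ] V2 :=
  bil ![![α • e2, 0], ![e1, (2 : ℂ) • e2]]

/-- The second multiplication of `C20^{α,β}`: `e2∗e1 = α e1, e2∗e2 = e1 + β e2`. -/
noncomputable def C20s (α β : ℂ) : V2 →ₗ[ℂ] V2 →ₗ[ℂ] V2 :=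
  bil ![![0, 0], ![α • e1, e1 + β • e2]]

/-- The second multiplication of `C21^{α,β}`: `e2∗e1 = α e1, e2∗e2 = β e2`. -/
noncomputable def C21s (α β : ℂ) : V2 →ₗ[ℂ] V2 →ₗ[ℂ] V2 :=
  bil ![![0, 0], ![α • e1, β • e2]]

/-- The second multiplication of `C22^{α,β}`: `e1∗e2 = α e1, e2∗e1 = β e1, e2∗e2 = e1 + α e2`. -/
noncomputable def C22s (α β : ℂ) : V2 →ₗ[ℂ] V2 →ₗ[ℂ] V2 :=
  bil ![![0, α • e1], ![β • e1, e1 + α • e2]]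

/-- The second multiplication of `C23^{α,β}`: `e1∗e2 = α e1, e2∗e1 = β e1, e2∗e2 = α e2`. -/
noncomputable def C23s (α β : ℂ) : V2 →ₗ[ℂ] V2 →ₗ[ℂ] V2 :=
  bil ![![0, α • e1], ![β • e1, α • e2]]

/-- The second multiplication of `C24^{α,β,γ}`: `e1∗e1 = β e1 + e2, e1∗e2 = γ e2`. -/
noncomputable def C24s (β γ : ℂ) : V2 →ₗ[ℂ] V2 →ₗ[ℂ] V2 :=
  bil ![![β • e1 + e2, γ • e2], ![0, 0]]

/-- The second multiplication of `C25^{α,β,γ}`: `e1∗e1 = β e1, e1∗e2 = γ e2`. -/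
noncomputable def C25s (β γ : ℂ) : V2 →ₗ[ℂ] V2 →ₗ[ℂ] V2 :=
  bil ![![β • e1, γ • e2], ![0, 0]]

/-- The second multiplication of `C29^α`: `e1∗e1 = α e1, e2∗e2 = e2`. -/
noncomputable def C29s (α : ℂ) : V2 →ₗ[ℂ] V2 →ₗ[ℂ] V2 :=
  bil ![![α • e1, 0], ![0, e2]]

/-- The second multiplication of `C30^{α,β}`:
`e1∗e1 = α e1 + β e2, e1∗e2 = e1, e2∗e1 = e1, e2∗e2 = e2`. -/
noncomputable def C30s (α β : ℂ) : V2 →ₗ[ℂ] V2 →ₗ[ℂ] V2 :=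
  bil ![![α • e1 + β • e2, e1], ![e1, e2]]

/-- The second multiplication of `C31^{α,β,γ}`:
`e1∗e1 = β e1 + e2, e1∗e2 = γ e2, e2∗e1 = β e2`. -/
noncomputable def C31s (β γ : ℂ) : V2 →ₗ[ℂ] V2 →ₗ[ℂ] V2 :=
  bil ![![β • e1 + e2, γ • e2], ![β • e2, 0]]

/-- The second multiplication of `C32^{α,β,γ}`:
`e1∗e1 = β e1, e1∗e2 = γ e2, e2∗e1 = β e2`. -/
noncomputable def C32s (β γ : ℂ) : V2 →ₗ[ℂ] V2 →ₗ[ℂ] V2 :=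
  bil ![![β • e1, γ • e2], ![β • e2, 0]]

/-- The second multiplication of `C34^{α,β}`:
`e1∗e1 = α e1, e1∗e2 = α e2, e2∗e1 = α e2, e2∗e2 = e1 + β e2`. -/
noncomputable def C34s (α β : ℂ) : V2 →ₗ[ℂ] V2 →ₗ[ℂ] V2 :=
  bil ![![α • e1, α • e2], ![α • e2, e1 + β • e2]]

/-- The second multiplication of `C35^α`:
`e1∗e1 = α e1, e1∗e2 = α e2, e2∗e1 = α e2, e2∗e2 = e2`. -/
noncomputable def C35s (α : ℂ) : V2 →ₗ[ℂ] V2 →ₗ[ℂ] V2 :=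
  bil ![![α • e1, α • e2], ![α • e2, e2]]

/-- The second multiplication of `C38^{α,β,γ}`:
`e1∗e1 = (γ+β−α) e1 − β e2, e1∗e2 = α e1 + β e2, e2∗e1 = α e1 + β e2, e2∗e2 = −α e1 + γ e2`. -/
noncomputable def C38s (α β γ : ℂ) : V2 →ₗ[ℂ] V2 →ₗ[ℂ] V2 :=
  bil ![![(γ + β - α) • e1 - β • e2, α • e1 + β • e2],
        ![α • e1 + β • e2, (-α) • e1 + γ • e2]]

/-- The second multiplication of `C39^{α,β}`: `e1∗e1 = α e1, e2∗e2 = β e2`. -/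
noncomputable def C39s (α β : ℂ) : V2 →ₗ[ℂ] V2 →ₗ[ℂ] V2 :=
  bil ![![α • e1, 0], ![0, β • e2]]

/-- The second multiplication of `C40^{α,β,γ}`:
`e1∗e1 = α e1 + β e2, e1∗e2 = 2α e2, e2∗e1 = γ e1 + α e2, e2∗e2 = 2γ e2`. -/
noncomputable def C40s (α β γ : ℂ) : V2 →ₗ[ℂ] V2 →ₗ[ℂ] V2 :=
  bil ![![α • e1 + β • e2, (2 * α) • e2], ![γ • e1 + α • e2, (2 * γ) • e2]]

/-- The second multiplication of `C41^{α,β}`: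
`e1∗e1 = α e1, e1∗e2 = β e1 + 2α e2, e2∗e1 = (2β + α/2) e1 + α e2,
e2∗e2 = (β/2) e1 + (α+β) e2`. -/
noncomputable def C41s (α β : ℂ) : V2 →ₗ[ℂ] V2 →ₗ[ℂ] V2 :=
  bil ![![α • e1, β • e1 + (2 * α) • e2],
        ![(2 * β + α / 2) • e1 + α • e2, (β / 2) • e1 + (α + β) • e2]]

theorem C39s_apply (α β : ℂ) (x y : V2) :
    C39s α β x y = ![α * (x 0 * y 0), β * (x 1 * y 1)] := by
  ext i
  fin_cases i <;> simp [C39s, bil, e1, e2, Fin.sum_univ_two] <;> ring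

theorem C07_eq_C39s : C07 = C39s 1 1 := by
  simp [C07, C39s]

theorem CompatIso.refl (μ ν : V2 →ₗ[ℂ] V2 →ₗ[ℂ] V2) : CompatIso μ ν μ ν :=
  ⟨LinearEquiv.refl ℂ V2, fun _ _ => rfl, fun _ _ => rfl⟩

/-- Exchanging the two coordinates of `ℂ²` exchanges the parameters of `C39s`. -/
theorem swap_C39s (α β : ℂ) (x y : V2) :
    LinearEquiv.funCongrLeft ℂ ℂ (Equiv.swap (0 : Fin 2) 1) (C39s α β x y) =
      C39s β α (LinearEquiv.funCongrLeft ℂ ℂ (Equiv.swap 0 1) x)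
        (LinearEquiv.funCongrLeft ℂ ℂ (Equiv.swap 0 1) y) := by
  ext i
  fin_cases i <;> simp [C39s_apply, LinearEquiv.funCongrLeft_apply, LinearMap.funLeft_apply]

theorem C39_iso_swap (α β : ℂ) : CompatIso C07 (C39s α β) C07 (C39s β α) :=
  ⟨LinearEquiv.funCongrLeft ℂ ℂ (Equiv.swap 0 1),
    by rw [C07_eq_C39s]; exact swap_C39s 1 1, swap_C39s α β⟩

/-- A multiplicative linear automorphism of `C07` permutes `e1` and `e2`. -/
theorem C07_aut_basis (φ : V2 ≃ₗ[ℂ] V2) (h : ∀ x y : V2, φ (C07 x y) = C07 (φ x) (φ y)) :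
    (φ e1 = e1 ∧ φ e2 = e2) ∨ (φ e1 = e2 ∧ φ e2 = e1) := by
  have idem (v : V2) (hv : C07 v v = v) (i : Fin 2) : φ v i = 0 ∨ φ v i = 1 := by
    have hi := congrFun (h v v) i
    rw [hv, C07_eq_C39s, C39s_apply] at hi
    have : φ v i * (φ v i - 1) = 0 := by
      fin_cases i <;> simp at hi ⊢ <;> grind
    grind
  have h11 : C07 e1 e1 = e1 := by rw [C07_eq_C39s, C39s_apply]; simp [e1]
  have h22 : C07 e2 e2 = e2 := by rw [C07_eq_C39s, C39s_apply]; simp [e2]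
  have h12 : C07 e1 e2 = 0 := by rw [C07_eq_C39s, C39s_apply]; simp [e1, e2]
  have horth := h e1 e2
  rw [h12, map_zero, C07_eq_C39s, C39s_apply] at horth
  have ho0 : φ e1 0 * φ e2 0 = 0 := by simpa using (congrFun horth 0).symm
  have ho1 : φ e1 1 * φ e2 1 = 0 := by simpa using (congrFun horth 1).symm
  have ne_zero (v : V2) (hv : v ≠ 0) : ¬(φ v 0 = 0 ∧ φ v 1 = 0) := fun ⟨h0, h1⟩ =>
    hv (φ.map_eq_zero_iff.mp (by ext i; fin_cases i <;> assumption))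
  have hne1 := ne_zero e1 (by simp [e1])
  have hne2 := ne_zero e2 (by simp [e2])
  have ext2 (v w : V2) : v = w ↔ v 0 = w 0 ∧ v 1 = w 1 := by
    rw [funext_iff, Fin.forall_fin_two]
  have e10 : e1 0 = 1 := rfl
  have e11 : e1 1 = 0 := rfl
  have e20 : e2 0 = 0 := rfl
  have e21 : e2 1 = 1 := rfl
  rw [ext2, ext2, ext2, ext2, e10, e11, e20, e21]
  have a0 := idem e1 h11 0
  have a1 := idem e1 h11 1
  have b0 := idem e2 h22 0
  have b1 := idem e2 h22 1
  grind

/-- For `β ≠ α`, `β' ≠ α'`: `C39^{α,β} ≅ C39^{α',β'}` iff `(α,β) = (α',β')` or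
`(α,β) = (β',α')`. -/
theorem C39_iso_iff (α β α' β' : ℂ) (hβ : β ≠ α) (hβ' : β' ≠ α') :
    CompatIso C07 (C39s α β) C07 (C39s α' β') ↔
      ((α, β) = (α', β') ∨ (α, β) = (β', α')) := by
  constructor
  · rintro ⟨φ, h, h'⟩
    have h1 := h' e1 e1
    have h2 := h' e2 e2
    have hs1 (a b : ℂ) : C39s a b e1 e1 = a • e1 := by rw [C39s_apply]; simp [e1]
    have hs2 (a b : ℂ) : C39s a b e2 e2 = b • e2 := by rw [C39s_apply]; simp [e2]
    rw [hs1, map_smul] at h1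
    rw [hs2, map_smul] at h2
    rcases C07_aut_basis φ h with ⟨k1, k2⟩ | ⟨k1, k2⟩
    · rw [k1, hs1] at h1
      rw [k2, hs2] at h2
      left
      simpa [e1, e2] using And.intro h1 h2
    · rw [k1, hs2] at h1
      rw [k2, hs1] at h2
      right
      simpa [e1, e2] using And.intro h1 h2
  · rintro (h | h) <;> obtain ⟨rfl, rfl⟩ := Prod.mk.inj h
    · exact CompatIso.refl _ _
    · exact C39_iso_swap _ _
end

section
/- For α,β,γ ∈ ℂ, let C40^{α,β,γ} be the compatible pre-Lie algebra on ℂ² with first multiplication e1·e1 = e1, e1·e2 = 2 e2, e2·e1 = (1/2) e1 + e2, e2·e2 = e2 and second multiplication e1∗e1 = α e1 + β e2, e1∗e2 = 2α e2, e2∗e1 = γ e1 + α e2, e2∗e2 = 2γ e2. Then C40^{α,β,γ} and C40^{α',β',γ'} are isomorphic as compatible pre-Lie algebras if and only if (α',β',γ') = (α,β,γ) or (α',β',γ') = (4γ − α, β − 8α + 16γ, γ). -/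
open scoped BigOperators

theorem bil_apply (f : Fin 2 → Fin 2 → V2) (x y : V2) :
    bil f x y = ∑ i : Fin 2, ∑ j : Fin 2, (x i * y j) • f i j := rfl

theorem C08_apply (a b c d : ℂ) :
    C08 ![a, b] ![c, d] = ![a * c + b * c / 2, 2 * a * d + b * c + b * d] := by
  ext i
  fin_cases i <;> simp [C08, bil_apply, e1, e2, Fin.sum_univ_two] <;> ring

theorem C40s_apply (α β γ a b c d : ℂ) :
    C40s α β γ ![a, b] ![c, d] =
      ![α * a * c + γ * b * c,
        β * a * c + 2 * α * a * d + α * b * c + 2 * γ * b * d] := by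
  ext i
  fin_cases i <;> simp [C40s, bil_apply, e1, e2, Fin.sum_univ_two] <;> ring

theorem V2.eta (x : V2) : x = ![x 0, x 1] := by
  ext i
  fin_cases i <;> rfl

/-- The involution `e1 ↦ -e1 + 4 e2`, `e2 ↦ e2`, the nontrivial automorphism of `C08`. -/
noncomputable def C08Involution : V2 ≃ₗ[ℂ] V2 :=
  LinearEquiv.ofInvolutive
    { toFun := fun x => ![-x 0, 4 * x 0 + x 1]
      map_add' := fun x y => by
        ext i
        fin_cases i <;> simp <;> ring
      map_smul' := fun c x => by
        ext i
        fin_cases i <;> simp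
        ring }
    (fun x => by
      ext i
      fin_cases i <;> simp)

theorem C08Involution_apply (a b : ℂ) : C08Involution ![a, b] = ![-a, 4 * a + b] := rfl

theorem equiv_apply_vec (φ : V2 ≃ₗ[ℂ] V2) (a b : ℂ) :
    φ ![a, b] = ![a * φ e1 0 + b * φ e2 0, a * φ e1 1 + b * φ e2 1] := by
  have h : (![a, b] : V2) = a • e1 + b • e2 := by
    ext i
    fin_cases i <;> simp [e1, e2]
  rw [h, map_add, map_smul, map_smul]
  ext i
  fin_cases i <;> simp

/-- The nonzero idempotents of `C08` are `e1`, `e2` and `-e1 + 4 e2`. -/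
theorem C08_idempotent {u : V2} (h : C08 u u = u) (h0 : u ≠ 0) :
    u = ![1, 0] ∨ u = ![0, 1] ∨ u = ![-1, 4] := by
  obtain ⟨a, b, rfl⟩ : ∃ a b, u = ![a, b] := ⟨_, _, V2.eta u⟩
  simp [C08_apply] at h h0 ⊢
  grind

/-- An automorphism of `C08` fixes `e2`, and sends `e1` to `e1` or to `-e1 + 4 e2`. -/
theorem C08_automorphism (φ : V2 ≃ₗ[ℂ] V2) (hφ : ∀ x y, φ (C08 x y) = C08 (φ x) (φ y)) :
    φ e2 = ![0, 1] ∧ (φ e1 = ![1, 0] ∨ φ e1 = ![-1, 4]) := by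
  have he11 : C08 e1 e1 = e1 := by simp [e1, C08_apply]
  have he12 : C08 e1 e2 = (2 : ℂ) • e2 := by simp [e1, e2, C08_apply]
  have he22 : C08 e2 e2 = e2 := by simp [e2, C08_apply]
  have hne : φ e1 ≠ φ e2 := φ.injective.ne fun h => by
    simpa [e1, e2] using congrFun h 0
  have h1 : φ e1 ≠ 0 := φ.map_ne_zero_iff.mpr fun h => by
    simpa [e1] using congrFun h 0
  have h2 : φ e2 ≠ 0 := φ.map_ne_zero_iff.mpr fun h => by
    simpa [e2] using congrFun h 1
  have h11 : C08 (φ e1) (φ e1) = φ e1 := by rw [← hφ, he11]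
  have h12 : C08 (φ e1) (φ e2) = (2 : ℂ) • φ e2 := by rw [← hφ, he12, map_smul]
  have h22 : C08 (φ e2) (φ e2) = φ e2 := by rw [← hφ, he22]
  rcases C08_idempotent h11 h1 with h | h | h <;>
    rcases C08_idempotent h22 h2 with h' | h' | h' <;>
    simp [h, h', C08_apply] at h12 hne ⊢
  norm_num at h12

/-- `C40^{α,β,γ} ≅ C40^{α',β',γ'}` iff `(α',β',γ') = (α,β,γ)` or
`(α',β',γ') = (4γ − α, β − 8α + 16γ, γ)`. -/
theorem C40_iso_iff (α β γ α' β' γ' : ℂ) :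
    CompatIso C08 (C40s α β γ) C08 (C40s α' β' γ') ↔
      ((α', β', γ') = (α, β, γ) ∨
        (α', β', γ') = (4 * γ - α, β - 8 * α + 16 * γ, γ)) := by
  constructor
  · rintro ⟨φ, hμ, hν⟩
    obtain ⟨h2, h1⟩ := C08_automorphism φ hμ
    have h11 := hν ![1, 0] ![1, 0]
    have h21 := hν ![0, 1] ![1, 0]
    have h22 := hν ![0, 1] ![0, 1]
    rcases h1 with h1 | h1
    · left
      simp [C40s_apply, equiv_apply_vec, h1, h2] at h11 h21 h22
      grind
    · right
      simp [C40s_apply, equiv_apply_vec, h1, h2] at h11 h21 h22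
      grind
  · rintro (h | h) <;> simp only [Prod.mk.injEq] at h <;> obtain ⟨rfl, rfl, rfl⟩ := h
    · exact ⟨LinearEquiv.refl ℂ V2, fun _ _ => rfl, fun _ _ => rfl⟩
    · refine ⟨C08Involution, fun x y => ?_, fun x y => ?_⟩ <;> rw [V2.eta x, V2.eta y]
      · simp only [C08_apply, C08Involution_apply]
        congr 1
        · ring
        · congr 1
          ring
      · simp only [C40s_apply, C08Involution_apply]
        congr 1
        · ring
        · congr 1
          ring
end

section
/- Let (ℂ², μ, ν) be a compatible commutative associative algebra with (μ,ν) ≠ (0,0). Then (ℂ², μ, ν) is isomorphic to one of the following algebras, where in each case the first multiplication is · and the second is ∗, unlisted products of basis vectors are zero, and α, β, γ range over ℂ: C03: e1∗e1 = e2; C05^0: e1∗e1 = e1; C06^1: e1∗e1 = e1, e1∗e2 = e2, e2∗e1 = e2; C07: e1∗e1 = e1, e2∗e2 = e2; C13^1: e1·e1 = e2, e1∗e1 = e1, e1∗e2 = e2, e2∗e1 = e2; C15^α: e1·e1 = e2, e1∗e1 = α e2; C16^0: e1·e1 = e2, e1∗e1 = e1; C18^α: e1·e1 = e2, e1∗e1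 = α e2, e1∗e2 = e1, e2∗e1 = e1, e2∗e2 = e2; C24^{0,β,0}: e1·e1 = e1, e1∗e1 = β e1 + e2; C25^{0,β,0}: e1·e1 = e1, e1∗e1 = β e1; C29^α: e1·e1 = e1, e1∗e1 = α e1, e2∗e2 = e2; C30^{α,β}: e1·e1 = e1, e1∗e1 = α e1 + β e2, e1∗e2 = e1, e2∗e1 = e1, e2∗e2 = e2; C31^{1,β,β}: e1·e1 = e1, e1·e2 = e2, e2·e1 = e2, e1∗e1 = β e1 + e2, e1∗e2 = β e2, e2∗e1 = β e2; C32^{1,β,β}: e1·e1 = e1, e1·e2 = e2, e2·e1 = e2, e1∗e1 = β e1, e1∗e2 = β e2, e2∗e1 = β e2; C34^{α,β}: e1·e1 = e1, e1·e2 = e2, e2·e1 = e2, e1∗e1 = α e1, e1∗e2 = α e2, e2∗e1 = α e2, e2∗e2 = e1 + β e2; C35^α: e1·e1 = e1, e1·e2 = e2, e2·e1 = e2, e1∗e1 = α e1, e1∗e2 = α e2, e2∗e1 = α e2, e2∗e2 = e2; C38^{α,β,γ}: e1·e1 = e1, e2·e2 = e2, e1∗e1 = (γ + β − α) e1 − β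 e2, e1∗e2 = α e1 + β e2, e2∗e1 = α e1 + β e2, e2∗e2 = −α e1 + γ e2; C39^{α,β} with β ≠ α: e1·e1 = e1, e2·e2 = e2, e1∗e1 = α e1, e2∗e2 = β e2. -/
open scoped BigOperators

/-- `μ` is commutative. -/
def IsComm (μ : V2 →ₗ[ℂ] V2 →ₗ[ℂ] V2) : Prop := ∀ x y : V2, μ x y = μ y x

/-- `μ` is associative. -/
def IsAssoc (μ : V2 →ₗ[ℂ] V2 →ₗ[ℂ] V2) : Prop :=
  ∀ x y z : V2, μ (μ x y) z = μ x (μ y z)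

/-- Structure constants of a commutative multiplication on a plane with basis `u, v`:
`u·u = a u + b v`, `u·v = v·u = c u + d v`, `v·v = f u + g v`. -/
structure Table where
  a : ℂ
  b : ℂ
  c : ℂ
  d : ℂ
  f : ℂ
  g : ℂ

/-- `T` is the multiplication table of `μ` in the basis `u, v`. -/
structure HasTable (μ : V2 →ₗ[ℂ] V2 →ₗ[ℂ] V2) (u v : V2) (T : Table) : Prop where
  uu : μ u u = T.a • u + T.b • v
  uv : μ u v = T.c • u + T.d • v
  vu : μ v u = T.c • u + T.d • v
  vv : μ v v = T.f • u + T.g • v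

/-- The table `T'` describes, in the basis `p u + q v, r u + s v`, the multiplication whose table
in the basis `u, v` is `T`. -/
structure IsChange (p q r s : ℂ) (T T' : Table) : Prop where
  uu₁ : p ^ 2 * T.a + 2 * p * q * T.c + q ^ 2 * T.f = T'.a * p + T'.b * r
  uu₂ : p ^ 2 * T.b + 2 * p * q * T.d + q ^ 2 * T.g = T'.a * q + T'.b * s
  uv₁ : p * r * T.a + (p * s + q * r) * T.c + q * s * T.f = T'.c * p + T'.d * r
  uv₂ : p * r * T.b + (p * s + q * r) * T.d + q * s * T.g = T'.c * q + T'.d * s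
  vv₁ : r ^ 2 * T.a + 2 * r * s * T.c + s ^ 2 * T.f = T'.f * p + T'.g * r
  vv₂ : r ^ 2 * T.b + 2 * r * s * T.d + s ^ 2 * T.g = T'.f * q + T'.g * s

/-- The equations on structure constants expressing associativity. -/
structure Table.Assoc (T : Table) : Prop where
  fst : T.c * T.d = T.b * T.f
  snd : T.a * T.d + T.b * T.g = T.c * T.b + T.d ^ 2
  trd : T.c ^ 2 + T.d * T.f = T.a * T.f + T.c * T.g

/-- The equations on structure constants expressing the compatibility of two associative
multiplications. -/
structure Table.Compat (T S : Table) : Prop where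
  fst : T.c * S.d + S.c * T.d = T.b * S.f + S.b * T.f
  snd : T.a * S.d + S.a * T.d + T.b * S.g + S.b * T.g =
    T.c * S.b + S.c * T.b + 2 * T.d * S.d
  trd : 2 * T.c * S.c + T.d * S.f + S.d * T.f =
    T.a * S.f + S.a * T.f + T.c * S.g + S.c * T.g

section Tables

variable {μ ν μ' ν' : V2 →ₗ[ℂ] V2 →ₗ[ℂ] V2} {u v : V2} {T S T' S' : Table} {p q r s : ℂ}

theorem HasTable.change (h : HasTable μ u v T) (hT : IsChange p q r s T T') :
    HasTable μ (p • u + q • v) (r • u + s • v) T' := by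
  obtain ⟨uu, uv, vu, vv⟩ := h
  obtain ⟨h1, h2, h3, h4, h5, h6⟩ := hT
  constructor <;>
    simp only [map_add, map_smul, LinearMap.add_apply, LinearMap.smul_apply, uu, uv, vu, vv] <;>
    match_scalars
  · linear_combination h1
  · linear_combination h2
  · linear_combination h3
  · linear_combination h4
  · linear_combination h3
  · linear_combination h4
  · linear_combination h5
  · linear_combination h6

theorem linearIndependent_change (h : LinearIndependent ℂ ![u, v]) (hd : p * s - q * r ≠ 0) :
    LinearIndependent ℂ ![p • u + q • v, r • u + s • v] := by
  rw [LinearIndependent.pair_iff] at h ⊢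
  intro x y hxy
  obtain ⟨h1, h2⟩ := h (x * p + y * r) (x * q + y * s) (by rw [← hxy]; module)
  constructor
  · refine (mul_eq_zero.1 (?_ : x * (p * s - q * r) = 0)).resolve_right hd
    linear_combination s * h1 - r * h2
  · refine (mul_eq_zero.1 (?_ : y * (p * s - q * r) = 0)).resolve_right hd
    linear_combination p * h2 - q * h1

theorem exists_basis_eq (h : LinearIndependent ℂ ![u, v]) :
    ∃ b : Module.Basis (Fin 2) ℂ V2, b 0 = u ∧ b 1 = v :=
  ⟨basisOfLinearIndependentOfCardEqFinrank h (by simp), by simp, by simp⟩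

theorem exists_hasTable (h : LinearIndependent ℂ ![u, v]) (hc : IsComm μ) :
    ∃ T, HasTable μ u v T := by
  obtain ⟨b, rfl, rfl⟩ := exists_basis_eq h
  have key (x : V2) : x = b.repr x 0 • b 0 + b.repr x 1 • b 1 := by
    rw [← Fin.sum_univ_two (fun i => b.repr x i • b i), b.sum_repr]
  exact ⟨⟨_, _, _, _, _, _⟩, key _, key _, (hc _ _).trans (key _), key _⟩

theorem compatIso_of_hasTable (h : LinearIndependent ℂ ![u, v])
    (hμ : HasTable μ u v T) (hν : HasTable ν u v S)
    (hμ' : HasTable μ' e1 e2 T) (hν' : HasTable ν' e1 e2 S) : CompatIso μ ν μ' ν' := by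
  obtain ⟨b, rfl, rfl⟩ := exists_basis_eq h
  have h0 : b.equivFun (b 0) = e1 := by
    ext i; fin_cases i <;> simp [e1]
  have h1 : b.equivFun (b 1) = e2 := by
    ext i; fin_cases i <;> simp [e2]
  have key {κ κ' : V2 →ₗ[ℂ] V2 →ₗ[ℂ] V2} {R : Table} (hκ : HasTable κ (b 0) (b 1) R)
      (hκ' : HasTable κ' e1 e2 R) (x y : V2) :
      b.equivFun (κ x y) = κ' (b.equivFun x) (b.equivFun y) := by
    have : κ.compr₂ b.equivFun.toLinearMap =
        κ'.compl₁₂ b.equivFun.toLinearMap b.equivFun.toLinearMap := by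
      refine b.ext fun i => b.ext fun j => ?_
      fin_cases i <;> fin_cases j <;>
        simp only [LinearMap.compr₂_apply, LinearMap.compl₁₂_apply, LinearEquiv.coe_coe,
          Fin.zero_eta, Fin.mk_one, h0, h1, hκ.uu, hκ.uv, hκ.vu, hκ.vv, hκ'.uu, hκ'.uv, hκ'.vu,
          hκ'.vv, map_add, map_smul]
    exact LinearMap.congr_fun₂ this x y
  exact ⟨b.equivFun, key hμ hμ', key hν hν'⟩

theorem compatIso_of_isChange (h : LinearIndependent ℂ ![u, v])
    (hμ : HasTable μ u v T) (hν : HasTable ν u v S) (p q r s : ℂ) (hd : p * s - q * r ≠ 0)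
    (hT : IsChange p q r s T T') (hS : IsChange p q r s S S')
    (hμ' : HasTable μ' e1 e2 T') (hν' : HasTable ν' e1 e2 S') : CompatIso μ ν μ' ν' :=
  compatIso_of_hasTable (linearIndependent_change h hd) (hμ.change hT) (hν.change hS) hμ' hν'

theorem HasTable.assoc (h : HasTable μ u v T) (hi : LinearIndependent ℂ ![u, v])
    (ha : IsAssoc μ) : T.Assoc := by
  obtain ⟨uu, uv, vu, vv⟩ := h
  rw [LinearIndependent.pair_iff] at hi
  have e := ha u u v
  have e' := ha u v v
  simp only [map_add, map_smul, LinearMap.add_apply, LinearMap.smul_apply, uu, uv, vv] at e e'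
  obtain ⟨h1, h2⟩ := hi (T.a * T.c + T.b * T.f - (T.c * T.a + T.d * T.c))
    (T.a * T.d + T.b * T.g - (T.c * T.b + T.d * T.d)) (by
      rw [← sub_eq_zero] at e; rw [← e]; module)
  obtain ⟨h3, -⟩ := hi (T.c * T.c + T.d * T.f - (T.f * T.a + T.g * T.c))
    (T.c * T.d + T.d * T.g - (T.f * T.b + T.g * T.d)) (by
      rw [← sub_eq_zero] at e'; rw [← e']; module)
  exact ⟨by linear_combination -h1, by linear_combination h2, by linear_combination h3⟩

theorem HasTable.compat (h : HasTable μ u v T) (h' : HasTable ν u v S)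
    (hi : LinearIndependent ℂ ![u, v]) (hμ : IsAssoc μ) (hν : IsAssoc ν)
    (hs : IsAssoc (μ + ν)) : T.Compat S := by
  have hT := h.assoc hi hμ
  have hS := h'.assoc hi hν
  have hadd : HasTable (μ + ν) u v
      ⟨T.a + S.a, T.b + S.b, T.c + S.c, T.d + S.d, T.f + S.f, T.g + S.g⟩ := by
    constructor <;>
      simp only [LinearMap.add_apply, h.uu, h.uv, h.vu, h.vv, h'.uu, h'.uv, h'.vu, h'.vv] <;>
      module
  obtain ⟨h1, h2, h3⟩ := hadd.assoc hi hs
  exact ⟨by linear_combination h1 - hT.fst - hS.fst, by linear_combination h2 - hT.snd - hS.snd,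
    by linear_combination h3 - hT.trd - hS.trd⟩

theorem hasTable_zero : HasTable 0 u v ⟨0, 0, 0, 0, 0, 0⟩ := by
  constructor <;> simp

theorem HasTable.eq_zero (h : HasTable μ u v ⟨0, 0, 0, 0, 0, 0⟩)
    (hi : LinearIndependent ℂ ![u, v]) : μ = 0 := by
  obtain ⟨b, rfl, rfl⟩ := exists_basis_eq hi
  refine b.ext fun i => b.ext fun j => ?_
  fin_cases i <;> fin_cases j <;> simp [h.uu, h.uv, h.vu, h.vv]

end Tables

theorem linearIndependent_e1_e2 : LinearIndependent ℂ ![e1, e2] := by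
  rw [LinearIndependent.pair_iff]
  intro s t h
  exact ⟨by simpa [e1, e2] using congrFun h 0, by simpa [e1, e2] using congrFun h 1⟩

theorem hasTable_bil {f : Fin 2 → Fin 2 → V2} {T : Table} (h00 : f 0 0 = T.a • e1 + T.b • e2)
    (h01 : f 0 1 = T.c • e1 + T.d • e2) (h10 : f 1 0 = T.c • e1 + T.d • e2)
    (h11 : f 1 1 = T.f • e1 + T.g • e2) : HasTable (bil f) e1 e2 T := by
  constructor <;>
    simp only [bil, LinearMap.mk₂_apply, Fin.sum_univ_two, h00, h01, h10, h11] <;>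
    simp [e1, e2]

section Models

variable (α β γ : ℂ)

theorem hasTable_C03 : HasTable C03 e1 e2 ⟨0, 1, 0, 0, 0, 0⟩ := by
  apply hasTable_bil <;> simp

theorem hasTable_C05 : HasTable (C05 0) e1 e2 ⟨1, 0, 0, 0, 0, 0⟩ := by
  apply hasTable_bil <;> simp

theorem hasTable_C06 : HasTable (C06 1) e1 e2 ⟨1, 0, 0, 1, 0, 0⟩ := by
  apply hasTable_bil <;> simp

theorem hasTable_C07 : HasTable C07 e1 e2 ⟨1, 0, 0, 0, 0, 1⟩ := by
  apply hasTable_bil <;> simp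

theorem hasTable_C13s : HasTable (C13s 1) e1 e2 ⟨1, 0, 0, 1, 0, 0⟩ := by
  apply hasTable_bil <;> simp

theorem hasTable_C15s : HasTable (C15s α) e1 e2 ⟨0, α, 0, 0, 0, 0⟩ := by
  apply hasTable_bil <;> simp

theorem hasTable_C16s : HasTable (C16s 0) e1 e2 ⟨1, 0, 0, 0, 0, 0⟩ := by
  apply hasTable_bil <;> simp

theorem hasTable_C18s : HasTable (C18s α) e1 e2 ⟨0, α, 1, 0, 0, 1⟩ := by
  apply hasTable_bil <;> simp

theorem hasTable_C24s : HasTable (C24s β 0) e1 e2 ⟨β, 1, 0, 0, 0, 0⟩ := by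
  apply hasTable_bil <;> simp

theorem hasTable_C25s : HasTable (C25s β 0) e1 e2 ⟨β, 0, 0, 0, 0, 0⟩ := by
  apply hasTable_bil <;> simp

theorem hasTable_C29s : HasTable (C29s α) e1 e2 ⟨α, 0, 0, 0, 0, 1⟩ := by
  apply hasTable_bil <;> simp

theorem hasTable_C30s : HasTable (C30s α β) e1 e2 ⟨α, β, 1, 0, 0, 1⟩ := by
  apply hasTable_bil <;> simp

theorem hasTable_C31s : HasTable (C31s β β) e1 e2 ⟨β, 1, 0, β, 0, 0⟩ := by
  apply hasTable_bil <;> simp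

theorem hasTable_C32s : HasTable (C32s β β) e1 e2 ⟨β, 0, 0, β, 0, 0⟩ := by
  apply hasTable_bil <;> simp

theorem hasTable_C34s : HasTable (C34s α β) e1 e2 ⟨α, 0, 0, α, 1, β⟩ := by
  apply hasTable_bil <;> simp

theorem hasTable_C35s : HasTable (C35s α) e1 e2 ⟨α, 0, 0, α, 0, 1⟩ := by
  apply hasTable_bil <;> simp

theorem hasTable_C38s : HasTable (C38s α β γ) e1 e2 ⟨γ + β - α, -β, α, β, -α, γ⟩ := by
  apply hasTable_bil <;> simp [sub_eq_add_neg]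

theorem hasTable_C39s : HasTable (C39s α β) e1 e2 ⟨α, 0, 0, 0, 0, β⟩ := by
  apply hasTable_bil <;> simp

end Models

/-- The multiplication tables of the two-dimensional commutative associative algebras. -/
inductive IsNormal : Table → Prop
  | zero : IsNormal ⟨0, 0, 0, 0, 0, 0⟩
  | nilpotent : IsNormal ⟨0, 1, 0, 0, 0, 0⟩
  | idempotent : IsNormal ⟨1, 0, 0, 0, 0, 0⟩
  | dual : IsNormal ⟨1, 0, 0, 1, 0, 0⟩
  | split : IsNormal ⟨1, 0, 0, 0, 0, 1⟩

section NormalForm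

variable {μ : V2 →ₗ[ℂ] V2 →ₗ[ℂ] V2} {u v : V2} {T T' : Table}

/-- `μ` has a normal multiplication table in some basis. -/
def HasNormalForm (μ : V2 →ₗ[ℂ] V2 →ₗ[ℂ] V2) : Prop :=
  ∃ u v T, LinearIndependent ℂ ![u, v] ∧ HasTable μ u v T ∧ IsNormal T

theorem HasTable.hasNormalForm (h : HasTable μ u v T) (hi : LinearIndependent ℂ ![u, v])
    (p q r s : ℂ) (hd : p * s - q * r ≠ 0) (hT : IsChange p q r s T T') (hN : IsNormal T') :
    HasNormalForm μ :=
  ⟨_, _, T', linearIndependent_change hi hd, h.change hT, hN⟩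

/-- The case of an algebra generated by an element `u` with `u³ = c u + d u²`. -/
theorem HasTable.hasNormalForm_of_generator {c d : ℂ}
    (h : HasTable μ u v ⟨0, 1, c, d, c * d, c + d ^ 2⟩) (hi : LinearIndependent ℂ ![u, v]) :
    HasNormalForm μ := by
  obtain ⟨r, s, rfl, rfl⟩ : ∃ r s : ℂ, d = r + s ∧ c = -(r * s) := by
    obtain ⟨r, hr⟩ := IsAlgClosed.exists_root
      (Polynomial.X ^ 2 - Polynomial.C d * Polynomial.X - Polynomial.C c)
      (by
        have : (Polynomial.X ^ 2 - Polynomial.C d * Polynomial.X - Polynomial.C c).degree = 2 := by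
          compute_degree!
        simp [this])
    refine ⟨r, d - r, by ring, ?_⟩
    simp only [Polynomial.IsRoot, Polynomial.eval_sub, Polynomial.eval_pow, Polynomial.eval_X,
      Polynomial.eval_mul, Polynomial.eval_C] at hr
    linear_combination -hr
  by_cases hr : r = 0
  · subst hr
    by_cases hs : s = 0
    · subst hs
      exact h.hasNormalForm hi 1 0 0 1 (by norm_num) (by constructor <;> simp) .nilpotent
    · refine h.hasNormalForm hi 0 (1 / s ^ 2) (-s) 1 (by simp [hs]) ?_ .idempotent
      constructor <;> field_simp <;> ring
  by_cases hs : s = 0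
  · subst hs
    refine h.hasNormalForm hi 0 (1 / r ^ 2) (-r) 1 (by simp [hr]) ?_ .idempotent
    constructor <;> field_simp <;> ring
  by_cases hrs : r = s
  · subst hrs
    refine h.hasNormalForm hi (2 / r) (-1 / r ^ 2) (-r) 1 ?_ ?_ .dual
    · field_simp; norm_num [hr]
    · constructor <;> field_simp <;> ring
  · have hrs' : r - s ≠ 0 := sub_ne_zero.2 hrs
    have hsr' : s - r ≠ 0 := sub_ne_zero.2 (Ne.symm hrs)
    refine h.hasNormalForm hi (-s / (r * (r - s))) (1 / (r * (r - s)))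
      (r / (s * (r - s))) (-1 / (s * (r - s))) ?_ ?_ .split
    · have : -s / (r * (r - s)) * (-1 / (s * (r - s))) -
          1 / (r * (r - s)) * (r / (s * (r - s))) = -1 / (r * s * (r - s)) := by
        field_simp
        ring
      rw [this]
      exact div_ne_zero (by norm_num) (mul_ne_zero (mul_ne_zero hr hs) hrs')
    · constructor <;> field_simp <;> ring

theorem HasTable.hasNormalForm_of_ne_zero (h : HasTable μ u v T)
    (hi : LinearIndependent ℂ ![u, v]) (ha : T.Assoc) (hb : T.b ≠ 0) : HasNormalForm μ := by
  refine (h.change (p := 1) (q := 0) (r := T.a) (s := T.b) ?_).hasNormalForm_of_generator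
    (c := T.b * T.c - T.a * T.d) (d := T.a + T.d) (linearIndependent_change hi (by simpa using hb))
  obtain ⟨h1, h2, -⟩ := ha
  constructor <;> dsimp only
  · ring
  · ring
  · ring
  · ring
  · linear_combination -T.b * h1
  · linear_combination T.b * h2

theorem HasTable.swap (h : HasTable μ u v T) : HasTable μ v u ⟨T.g, T.f, T.d, T.c, T.b, T.a⟩ :=
  ⟨by rw [h.vv, add_comm], by rw [h.vu, add_comm], by rw [h.uv, add_comm], by rw [h.uu, add_comm]⟩

theorem linearIndependent_swap (hi : LinearIndependent ℂ ![u, v]) :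
    LinearIndependent ℂ ![v, u] := by
  simpa using linearIndependent_change hi (p := 0) (q := 1) (r := 1) (s := 0) (by norm_num)

theorem HasTable.hasNormalForm_of_eq_zero {a d g : ℂ} (h : HasTable μ u v ⟨a, 0, 0, d, 0, g⟩)
    (hi : LinearIndependent ℂ ![u, v]) (had : a * d = d ^ 2) : HasNormalForm μ := by
  by_cases hd : d = 0
  · subst hd
    by_cases ha : a = 0
    · subst ha
      by_cases hg : g = 0
      · subst hg
        exact ⟨u, v, _, hi, h, .zero⟩
      · refine h.hasNormalForm hi 0 (1 / g) 1 0 (by simpa using hg) ?_ .idempotent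
        constructor <;> field_simp <;> ring
    · by_cases hg : g = 0
      · subst hg
        refine h.hasNormalForm hi (1 / a) 0 0 1 (by simpa using ha) ?_ .idempotent
        constructor <;> field_simp <;> ring
      · refine h.hasNormalForm hi (1 / a) 0 0 (1 / g) (by simp [ha, hg]) ?_ .split
        constructor <;> field_simp <;> ring
  · obtain rfl : a = d := mul_right_cancel₀ hd (by linear_combination had)
    by_cases hg : g = 0
    · subst hg
      refine h.hasNormalForm hi (1 / a) 0 0 1 (by simpa using hd) ?_ .dual
      constructor <;> field_simp <;> ring
    · refine h.hasNormalForm hi (1 / a) (-1 / g) 0 (1 / g) (by simp [hd, hg]) ?_ .split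
      constructor <;> field_simp <;> ring

theorem hasNormalForm (hc : IsComm μ) (ha : IsAssoc μ) : HasNormalForm μ := by
  have hi := linearIndependent_e1_e2
  obtain ⟨⟨a, b, c, d, f, g⟩, h⟩ := exists_hasTable hi hc
  have hT := h.assoc hi ha
  have hi' := linearIndependent_swap hi
  by_cases hb : b = 0
  · by_cases hf : f = 0
    · subst hb hf
      obtain ⟨h1, h2, h3⟩ := hT
      by_cases hz : c = 0
      · subst hz
        exact h.hasNormalForm_of_eq_zero hi (by linear_combination h2)
      · obtain rfl : d = 0 := (mul_eq_zero.1 (h1.trans (by simp))).resolve_left hz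
        exact h.swap.hasNormalForm_of_eq_zero hi' (by linear_combination -h3)
    · exact h.swap.hasNormalForm_of_ne_zero hi' (h.swap.assoc hi' ha) hf
  · exact h.hasNormalForm_of_ne_zero hi hT hb

end NormalForm

section Compatible

variable {μ ν : V2 →ₗ[ℂ] V2 →ₗ[ℂ] V2} {u v : V2} {S : Table}

theorem compatIso_of_zero (hi : LinearIndependent ℂ ![u, v])
    (hμ : HasTable μ u v ⟨0, 0, 0, 0, 0, 0⟩) (hνc : IsComm ν) (hνa : IsAssoc ν)
    (hne : ¬(μ = 0 ∧ ν = 0)) :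
    CompatIso μ ν 0 C03 ∨ CompatIso μ ν 0 (C05 0) ∨ CompatIso μ ν 0 (C06 1) ∨
      CompatIso μ ν 0 C07 := by
  obtain rfl := hμ.eq_zero hi
  obtain ⟨u, v, T, hi, h, hN⟩ := hasNormalForm hνc hνa
  cases hN with
  | zero => exact absurd ⟨rfl, h.eq_zero hi⟩ hne
  | nilpotent => exact .inl (compatIso_of_hasTable hi hasTable_zero h hasTable_zero hasTable_C03)
  | idempotent =>
    exact .inr (.inl (compatIso_of_hasTable hi hasTable_zero h hasTable_zero hasTable_C05))
  | dual =>
    exact .inr (.inr (.inl (compatIso_of_hasTable hi hasTable_zero h hasTable_zero hasTable_C06)))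
  | split =>
    exact .inr (.inr (.inr (compatIso_of_hasTable hi hasTable_zero h hasTable_zero hasTable_C07)))

theorem compatIso_of_nilpotent (hi : LinearIndependent ℂ ![u, v])
    (hμ : HasTable μ u v ⟨0, 1, 0, 0, 0, 0⟩) (hν : HasTable ν u v S)
    (hS : S.Assoc) (hc : Table.Compat ⟨0, 1, 0, 0, 0, 0⟩ S) :
    CompatIso μ ν C03 (C13s 1) ∨ (∃ α : ℂ, CompatIso μ ν C03 (C15s α)) ∨
      CompatIso μ ν C03 (C16s 0) ∨ (∃ α : ℂ, CompatIso μ ν C03 (C18s α)) := by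
  obtain ⟨a, b, c, d, f, g⟩ := S
  obtain ⟨h1, h2, h3⟩ := hS
  obtain ⟨k1, k2, -⟩ := hc
  dsimp only at h1 h2 h3 k1 k2
  obtain rfl : f = 0 := by linear_combination -k1
  obtain rfl : g = c := by linear_combination k2
  by_cases hc : g = 0
  · subst hc
    by_cases hd : d = 0
    · subst hd
      by_cases ha : a = 0
      · subst ha
        exact .inr (.inl ⟨b, compatIso_of_hasTable hi hμ hν hasTable_C03 (hasTable_C15s b)⟩)
      · refine .inr (.inr (.inl (compatIso_of_isChange hi hμ hν (1 / a) (b / a ^ 2) 0 (1 / a ^ 2)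
          (by simpa using ha) ?_ ?_ hasTable_C03 hasTable_C16s)))
        all_goals constructor <;> field_simp <;> ring
    · obtain rfl : a = d := mul_right_cancel₀ hd (by linear_combination h2)
      refine .inl (compatIso_of_isChange hi hμ hν (1 / a) (-b / a ^ 2) 0 (1 / a ^ 2)
        (by simpa using hd) ?_ ?_ hasTable_C03 hasTable_C13s)
      all_goals constructor <;> field_simp <;> ring
  · obtain rfl : d = 0 := (mul_eq_zero.1 (h1.trans (by simp))).resolve_left hc
    obtain ⟨p, hp⟩ := IsAlgClosed.exists_pow_nat_eq g⁻¹ two_pos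
    have hp0 : p ≠ 0 := by
      rintro rfl
      exact inv_ne_zero hc (by simpa using hp.symm)
    obtain rfl : g = 1 / p ^ 2 := by rw [hp]; simp
    refine .inr (.inr (.inr ⟨b + p ^ 2 * a ^ 2 / 4,
      compatIso_of_isChange hi hμ hν p (-(p ^ 3 * a / 2)) 0 (p ^ 2)
        (by simpa using hp0) ?_ ?_ hasTable_C03 (hasTable_C18s _)⟩))
    all_goals constructor <;> field_simp <;> ring

theorem compatIso_of_idempotent (hi : LinearIndependent ℂ ![u, v])
    (hμ : HasTable μ u v ⟨1, 0, 0, 0, 0, 0⟩) (hν : HasTable ν u v S)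
    (hS : S.Assoc) (hc : Table.Compat ⟨1, 0, 0, 0, 0, 0⟩ S) :
    (∃ β : ℂ, CompatIso μ ν (C05 0) (C24s β 0)) ∨
      (∃ β : ℂ, CompatIso μ ν (C05 0) (C25s β 0)) ∨
      (∃ α : ℂ, CompatIso μ ν (C05 0) (C29s α)) ∨
      (∃ α β : ℂ, CompatIso μ ν (C05 0) (C30s α β)) := by
  obtain ⟨a, b, c, d, f, g⟩ := S
  obtain ⟨-, h2, h3⟩ := hS
  obtain ⟨-, k2, k3⟩ := hc
  dsimp only at h2 h3 k2 k3
  obtain rfl : d = 0 := by linear_combination k2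
  obtain rfl : f = 0 := by linear_combination -k3
  by_cases hc : c = 0
  · subst hc
    by_cases hg : g = 0
    · subst hg
      by_cases hb : b = 0
      · subst hb
        exact .inr (.inl ⟨a, compatIso_of_hasTable hi hμ hν hasTable_C05 (hasTable_C25s a)⟩)
      · refine .inl ⟨a, compatIso_of_isChange hi hμ hν 1 0 0 b (by simpa using hb) ?_ ?_
          hasTable_C05 (hasTable_C24s a)⟩
        all_goals constructor <;> ring
    · obtain rfl : b = 0 := mul_right_cancel₀ hg (by linear_combination h2)
      refine .inr (.inr (.inl ⟨a, compatIso_of_isChange hi hμ hν 1 0 0 (1 / g) (by simpa using hg)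
        ?_ ?_ hasTable_C05 (hasTable_C29s a)⟩))
      all_goals constructor <;> field_simp <;> ring
  · obtain rfl : g = c := mul_left_cancel₀ hc (by linear_combination -h3)
    refine .inr (.inr (.inr ⟨a, b * g, compatIso_of_isChange hi hμ hν 1 0 0 (1 / g)
      (by simpa using hc) ?_ ?_ hasTable_C05 (hasTable_C30s a (b * g))⟩))
    all_goals constructor <;> field_simp <;> ring

theorem compatIso_of_dual (hi : LinearIndependent ℂ ![u, v])
    (hμ : HasTable μ u v ⟨1, 0, 0, 1, 0, 0⟩) (hν : HasTable ν u v S)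
    (hS : S.Assoc) (hc : Table.Compat ⟨1, 0, 0, 1, 0, 0⟩ S) :
    (∃ β : ℂ, CompatIso μ ν (C06 1) (C31s β β)) ∨
      (∃ β : ℂ, CompatIso μ ν (C06 1) (C32s β β)) ∨
      (∃ α β : ℂ, CompatIso μ ν (C06 1) (C34s α β)) ∨
      (∃ α : ℂ, CompatIso μ ν (C06 1) (C35s α)) := by
  obtain ⟨a, b, c, d, f, g⟩ := S
  obtain ⟨h1, h2, -⟩ := hS
  obtain ⟨k1, k2, -⟩ := hc
  dsimp only at h1 h2 k1 k2
  obtain rfl : c = 0 := by linear_combination k1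
  obtain rfl : d = a := by linear_combination -k2
  by_cases hb : b = 0
  · subst hb
    by_cases hf : f = 0
    · subst hf
      by_cases hg : g = 0
      · subst hg
        exact .inr (.inl ⟨d, compatIso_of_hasTable hi hμ hν hasTable_C06 (hasTable_C32s d)⟩)
      · refine .inr (.inr (.inr ⟨d, compatIso_of_isChange hi hμ hν 1 0 0 (1 / g)
          (by simpa using hg) ?_ ?_ hasTable_C06 (hasTable_C35s d)⟩))
        all_goals constructor <;> field_simp <;> ring
    · obtain ⟨p, hp⟩ := IsAlgClosed.exists_pow_nat_eq f⁻¹ two_pos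
      have hp0 : p ≠ 0 := by
        rintro rfl
        exact inv_ne_zero hf (by simpa using hp.symm)
      obtain rfl : f = 1 / p ^ 2 := by rw [hp]; simp
      refine .inr (.inr (.inl ⟨d, p * g, compatIso_of_isChange hi hμ hν 1 0 0 p
        (by simpa using hp0) ?_ ?_ hasTable_C06 (hasTable_C34s d (p * g))⟩))
      all_goals constructor <;> field_simp <;> ring
  · obtain rfl : f = 0 := (mul_eq_zero.1 (h1.symm.trans (by simp))).resolve_left hb
    obtain rfl : g = 0 := mul_left_cancel₀ hb (by linear_combination h2)
    refine .inl ⟨d, compatIso_of_isChange hi hμ hν 1 0 0 b (by simpa using hb) ?_ ?_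
      hasTable_C06 (hasTable_C31s d)⟩
    all_goals constructor <;> ring

theorem compatIso_of_split (hi : LinearIndependent ℂ ![u, v])
    (hμ : HasTable μ u v ⟨1, 0, 0, 0, 0, 1⟩) (hν : HasTable ν u v S)
    (hS : S.Assoc) (hc : Table.Compat ⟨1, 0, 0, 0, 0, 1⟩ S) :
    (∃ α β γ : ℂ, CompatIso μ ν C07 (C38s α β γ)) ∨
      (∃ α β : ℂ, β ≠ α ∧ CompatIso μ ν C07 (C39s α β)) := by
  obtain ⟨a, b, c, d, f, g⟩ := S
  obtain ⟨-, h2, h3⟩ := hS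
  obtain ⟨-, k2, k3⟩ := hc
  dsimp only at h2 h3 k2 k3
  obtain rfl : b = -d := by linear_combination k2
  obtain rfl : f = -c := by linear_combination -k3
  by_cases ha : a = g + d - c
  · subst ha
    exact .inl ⟨c, d, g, compatIso_of_hasTable hi hμ hν hasTable_C07 (hasTable_C38s c d g)⟩
  · have ha' := sub_ne_zero.2 ha
    obtain rfl : d = 0 := mul_right_cancel₀ ha' (by linear_combination h2)
    obtain rfl : c = 0 := mul_right_cancel₀ ha' (by linear_combination h3)
    have hag : g ≠ a := by simpa [eq_comm] using ha
    rw [neg_zero] at hν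
    exact .inr ⟨a, g, hag, compatIso_of_hasTable hi hμ hν hasTable_C07 (hasTable_C39s a g)⟩

end Compatible

/-- Classification of nonzero 2-dimensional compatible commutative associative
algebras: `(ℂ², μ, ν)` is isomorphic to one of the listed algebras. -/
theorem classification_compatible_comm_assoc (μ ν : V2 →ₗ[ℂ] V2 →ₗ[ℂ] V2)
    (hμc : IsComm μ) (hμa : IsAssoc μ) (hνc : IsComm ν) (hνa : IsAssoc ν)
    (hsum : IsAssoc (μ + ν)) (hne : ¬(μ = 0 ∧ ν = 0)) :
    CompatIso μ ν 0 C03 ∨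
      CompatIso μ ν 0 (C05 0) ∨
      CompatIso μ ν 0 (C06 1) ∨
      CompatIso μ ν 0 C07 ∨
      CompatIso μ ν C03 (C13s 1) ∨
      (∃ α : ℂ, CompatIso μ ν C03 (C15s α)) ∨
      CompatIso μ ν C03 (C16s 0) ∨
      (∃ α : ℂ, CompatIso μ ν C03 (C18s α)) ∨
      (∃ β : ℂ, CompatIso μ ν (C05 0) (C24s β 0)) ∨
      (∃ β : ℂ, CompatIso μ ν (C05 0) (C25s β 0)) ∨
      (∃ α : ℂ, CompatIso μ ν (C05 0) (C29s α)) ∨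
      (∃ α β : ℂ, CompatIso μ ν (C05 0) (C30s α β)) ∨
      (∃ β : ℂ, CompatIso μ ν (C06 1) (C31s β β)) ∨
      (∃ β : ℂ, CompatIso μ ν (C06 1) (C32s β β)) ∨
      (∃ α β : ℂ, CompatIso μ ν (C06 1) (C34s α β)) ∨
      (∃ α : ℂ, CompatIso μ ν (C06 1) (C35s α)) ∨
      (∃ α β γ : ℂ, CompatIso μ ν C07 (C38s α β γ)) ∨
      (∃ α β : ℂ, β ≠ α ∧ CompatIso μ ν C07 (C39s α β)) := by
  obtain ⟨u, v, T, hi, hT, hN⟩ := hasNormalForm hμc hμa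
  obtain ⟨S, hS⟩ := exists_hasTable hi hνc
  have hSa := hS.assoc hi hνa
  have hTS := hT.compat hS hi hμa hνa hsum
  cases hN with
  | zero =>
    rcases compatIso_of_zero hi hT hνc hνa hne with h | h | h | h <;>
      simp only [h, true_or, or_true]
  | nilpotent =>
    rcases compatIso_of_nilpotent hi hT hS hSa hTS with h | h | h | h <;>
      simp only [h, true_or, or_true]
  | idempotent =>
    rcases compatIso_of_idempotent hi hT hS hSa hTS with h | h | h | h <;>
      simp only [h, true_or, or_true]
  | dual =>
    rcases compatIso_of_dual hi hT hS hSa hTS with h | h | h | h <;>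
      simp only [h, true_or, or_true]
  | split =>
    rcases compatIso_of_split hi hT hS hSa hTS with h | h <;>
      simp only [h, true_or, or_true]
end

section
/- For t ∈ ℂ with t ≠ 0, let μ be the bilinear multiplication on ℂ² with e1·e1 = e1, e2·e2 = e2, let ν_t be the bilinear multiplication with e1∗e1 = t⁻¹ e1, e2∗e2 = t⁻¹ e2 (the second multiplication of C38^{0,0,1/t}), and let φ_t : ℂ² → ℂ² be the linear map with φ_t(e1) = t e1, φ_t(e2) = t e2. Then for all x, y ∈ ℂ², as t → 0 (through nonzero values), φ_t⁻¹(μ(φ_t(x), φ_t(y))) tends to 0 and φ_t⁻¹(ν_t(φ_t(x), φ_t(y))) tends to λ(x,y), where λ is the bilinear multiplication with λ(e1,e1) = e1, λ(e2,e2) = e2 and all other products of basis vectors zero. Hence C38^{0,0,1/t} degenerates to the compatible pre-Lie algebra C07 = (ℂ², 0, λ). -/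
open scoped BigOperators

open Filter Topology

/-- A linear map acting as the scalar `t` on the standard basis acts as `t` everywhere. -/
theorem linearEquiv_apply_eq_smul {t : ℂ} (ψ : V2 ≃ₗ[ℂ] V2)
    (h : ψ e1 = t • e1 ∧ ψ e2 = t • e2) (x : V2) : ψ x = t • x := by
  have hx : x = x 0 • e1 + x 1 • e2 := by
    ext i
    fin_cases i <;> simp [e1, e2]
  rw [hx, map_add, map_smul, map_smul, h.1, h.2, smul_add, smul_comm t, smul_comm t]

/-- Transport of a bilinear multiplication along a scalar basis change. -/
theorem symm_bilinear_apply {t : ℂ} (ψ : V2 ≃ₗ[ℂ] V2)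
    (h : ψ e1 = t • e1 ∧ ψ e2 = t • e2) (μ : V2 →ₗ[ℂ] V2 →ₗ[ℂ] V2) (x y : V2) :
    ψ.symm (μ (ψ x) (ψ y)) = t • μ x y := by
  rw [LinearEquiv.symm_apply_eq]
  simp only [linearEquiv_apply_eq_smul ψ h, map_smul, LinearMap.smul_apply]

/-- The second multiplication of `C38^{0,0,c}` is `c` times the multiplication of `C07`. -/
theorem C38s_zero_zero (c : ℂ) (x y : V2) : C38s 0 0 c x y = c • C07 x y := by
  ext i
  fin_cases i <;> simp [C38s, C07, bil, e1, e2, Fin.sum_univ_two, mul_comm]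

/-- The degeneration `C38^{0,0,1/t} → C07` along the basis change
`φ_t(e1) = t e1, φ_t(e2) = t e2`: the transported first multiplication tends to `0`
and the transported second multiplication tends to the multiplication of `C07`. -/
theorem C38_degenerates_to_C07 (φ : ℂ → (V2 ≃ₗ[ℂ] V2))
    (hφ : ∀ t : ℂ, t ≠ 0 → φ t e1 = t • e1 ∧ φ t e2 = t • e2)
    (x y : V2) :
    Tendsto (fun t : ℂ => (φ t).symm (C07 (φ t x) (φ t y)))
        (nhdsWithin 0 {0}ᶜ) (nhds (0 : V2)) ∧
      Tendsto (fun t : ℂ => (φ t).symm (C38s 0 0 t⁻¹ (φ t x) (φ t y)))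
        (nhdsWithin 0 {0}ᶜ) (nhds (C07 x y)) := by
  refine ⟨?_, ?_⟩
  · have h : Tendsto (fun t : ℂ => t • C07 x y) (nhdsWithin 0 {0}ᶜ) (nhds (0 : V2)) := by
      have hc : Continuous fun t : ℂ => t • C07 x y := by fun_prop
      simpa using (hc.tendsto 0).mono_left nhdsWithin_le_nhds
    refine h.congr' ?_
    filter_upwards [self_mem_nhdsWithin] with t ht
    exact (symm_bilinear_apply (φ t) (hφ t ht) C07 x y).symm
  · refine tendsto_const_nhds.congr' ?_
    filter_upwards [self_mem_nhdsWithin] with t ht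
    rw [symm_bilinear_apply (φ t) (hφ t ht), C38s_zero_zero, smul_inv_smul₀ ht]
end
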